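/- arXiv:2511.06062 — 3 statements merged into one kernel-verified Lean document; each statement's English description precedes it below -/
import Mathlib

section
/- Assume the exact rank-one completion problem with data (Ω, T̂) has a unique solution T ∈ ℝ^⟦N⟧, and assume Σ_{β∈⟦N⟧} (x_β² − T_β²) = σ mod (I_2 + J_2) for some σ ∈ Σ_{N,2} that admits a Gram matrix Q ∈ 𝕊^{N+1} of rank N. Then the relaxation (SDP-E) is tight: 𝐗̄ is its unique optimal solution. -/
namespace RankOneTC

open scoped BigOperators
open MeasureTheory

/-- The index set `⟦N⟧ = [n 0] × ⋯ × [n (d-1)]`. -/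
abbrev Idx {d : ℕ} (n : Fin d → ℕ) : Type := ∀ i : Fin d, Fin (n i)

/-- A tensor is rank one if it is an outer product of `d` vectors. -/
def IsRankOne {d : ℕ} {n : Fin d → ℕ} (T : Idx n → ℝ) : Prop :=
  ∃ u : ∀ i : Fin d, Fin (n i) → ℝ, ∀ α : Idx n, T α = ∏ i : Fin d, u i (α i)

/-- `Ω` satisfies unique recovery: for any nonzero observed values, the rank-one
completion problem is infeasible or has exactly one solution. -/
def UniqueRecovery {d : ℕ} {n : Fin d → ℕ} (Ω : Set (Idx n)) : Prop :=
  ∀ That : Idx n → ℝ, (∀ α ∈ Ω, That α ≠ 0) →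
    {T : Idx n → ℝ | IsRankOne T ∧ ∀ α ∈ Ω, T α = That α}.Subsingleton

/-- The 𝔽₂ vector `v_α`, the concatenation of indicator vectors of the coordinates. -/
def vF2 {d : ℕ} {n : Fin d → ℕ} (α : Idx n) : (Σ i : Fin d, Fin (n i)) → ZMod 2 :=
  fun s => if α s.1 = s.2 then 1 else 0

/-- A generalized square: four distinct tuples whose `v`-vectors sum to zero over 𝔽₂. -/
def IsGenSquare {d : ℕ} {n : Fin d → ℕ} (α₁ α₂ α₃ α₄ : Idx n) : Prop :=
  [α₁, α₂, α₃, α₄].Nodup ∧ vF2 α₁ + vF2 α₂ + vF2 α₃ + vF2 α₄ = 0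

/-- A square `{α₁,α₂;α₃,α₄}`: four distinct tuples with coordinatewise equal max and min
of the two opposite pairs. -/
def IsSquare {d : ℕ} {n : Fin d → ℕ} (α₁ α₂ α₃ α₄ : Idx n) : Prop :=
  [α₁, α₂, α₃, α₄].Nodup ∧
    ∀ k : Fin d, max (α₁ k) (α₂ k) = max (α₃ k) (α₄ k) ∧
      min (α₁ k) (α₂ k) = min (α₃ k) (α₄ k)

/-- The GS-propagated set `𝒫_GS(Ω)` as an inductive predicate. -/
inductive PGS {d : ℕ} {n : Fin d → ℕ} (Ω : Set (Idx n)) : Idx n → Prop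
  | base {α : Idx n} : α ∈ Ω → PGS Ω α
  | prop {α₁ α₂ α₃ β : Idx n} : IsGenSquare α₁ α₂ α₃ β →
      PGS Ω α₁ → PGS Ω α₂ → PGS Ω α₃ → PGS Ω β

def GSPropagation {d : ℕ} {n : Fin d → ℕ} (Ω : Set (Idx n)) : Prop :=
  ∀ β : Idx n, PGS Ω β

/-- The S-propagated set `𝒫_S(Ω)` as an inductive predicate. -/
inductive PS {d : ℕ} {n : Fin d → ℕ} (Ω : Set (Idx n)) : Idx n → Prop
  | base {α : Idx n} : α ∈ Ω → PS Ω α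
  | prop {α₁ α₂ α₃ β : Idx n} : IsSquare α₁ α₂ α₃ β →
      PS Ω α₁ → PS Ω α₂ → PS Ω α₃ → PS Ω β

def SPropagation {d : ℕ} {n : Fin d → ℕ} (Ω : Set (Idx n)) : Prop :=
  ∀ β : Idx n, PS Ω β

/-- The SR-propagated set `𝒫_SR(Ω)` as an inductive predicate. -/
inductive PSR {d : ℕ} {n : Fin d → ℕ} (Ω : Set (Idx n)) : Idx n → Prop
  | base {α : Idx n} : α ∈ Ω → PSR Ω α
  | prop {α₁ β α₂ γ : Idx n} : IsSquare α₁ β α₂ γ →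
      α₁ ∈ Ω → α₂ ∈ Ω → PSR Ω β → PSR Ω γ

def SRPropagation {d : ℕ} {n : Fin d → ℕ} (Ω : Set (Idx n)) : Prop :=
  ∀ β : Idx n, PSR Ω β

/-- A sequence is strongly connected if each later element agrees with some earlier
element in exactly `d - 1` coordinates. -/
def StronglyConnected {d : ℕ} {n : Fin d → ℕ} {p : ℕ} (α : Fin p → Idx n) : Prop :=
  ∀ k : Fin p, 0 < (k : ℕ) → ∃ i : Fin p, i < k ∧
    (Finset.univ.filter fun j : Fin d => α k j = α i j).card = d - 1

/-- A-propagation: a strongly connected sequence of elements of `Ω` covering all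
coordinates. -/
def APropagation {d : ℕ} {n : Fin d → ℕ} (Ω : Set (Idx n)) : Prop :=
  ∃ (p : ℕ) (α : Fin p → Idx n), (∀ k, α k ∈ Ω) ∧ StronglyConnected α ∧
    ∀ (i : Fin d) (j : Fin (n i)), ∃ k : Fin p, α k i = j

/-- The 𝔽₂ matrix `V_Ω` whose rows are the vectors `v_α`, `α ∈ Ω`. -/
def maskMatrix {d : ℕ} {n : Fin d → ℕ} (Ω : Finset (Idx n)) :
    Matrix {α : Idx n // α ∈ Ω} (Σ i : Fin d, Fin (n i)) (ZMod 2) :=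
  Matrix.of fun α s => vF2 α.1 s

/-! ### SDP formulations -/

/-- The bordered matrix `𝐗 = [[1, xᵀ],[x, X]]`, indexed by `Option (Idx n)` where
`none` is the extra index. -/
def border {d : ℕ} {n : Fin d → ℕ} (x : Idx n → ℝ) (X : Matrix (Idx n) (Idx n) ℝ) :
    Matrix (Option (Idx n)) (Option (Idx n)) ℝ :=
  Matrix.of fun a b =>
    match a, b with
    | Option.none, Option.none => (1 : ℝ)
    | Option.none, Option.some β => x β
    | Option.some α, Option.none => x α
    | Option.some α, Option.some β => X α β

/-- Feasibility for the exact SDP relaxation (SDP-E). -/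
structure SDPEFeasible {d : ℕ} {n : Fin d → ℕ} (Ω : Set (Idx n)) (That : Idx n → ℝ)
    (x : Idx n → ℝ) (X : Matrix (Idx n) (Idx n) ℝ) : Prop where
  isSymm : X.IsSymm
  obs : ∀ α ∈ Ω, x α = That α
  obsDiag : ∀ α ∈ Ω, X α α = That α ^ 2
  squares : ∀ α₁ α₂ α₃ α₄ : Idx n, IsSquare α₁ α₂ α₃ α₄ → X α₁ α₂ = X α₃ α₄
  psd : (border x X).PosSemidef

/-- Tightness of (SDP-E): the matrix `𝐗̄` built from the completion `T` is feasible and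
is the unique minimizer of the trace objective. -/
def SDPETight {d : ℕ} {n : Fin d → ℕ} (Ω : Set (Idx n)) (That T : Idx n → ℝ) : Prop :=
  SDPEFeasible Ω That T (Matrix.vecMulVec T T) ∧
  ∀ x X, SDPEFeasible Ω That x X →
    Matrix.trace (Matrix.vecMulVec T T) ≤ Matrix.trace X ∧
    (Matrix.trace X = Matrix.trace (Matrix.vecMulVec T T) →
      x = T ∧ X = Matrix.vecMulVec T T)

/-- Tightness of the weighted relaxation (SDP-Eʷ) with weights `w`. -/
def SDPEwTight {d : ℕ} {n : Fin d → ℕ} (Ω : Set (Idx n)) (w : Idx n → ℝ)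
    (That T : Idx n → ℝ) : Prop :=
  SDPEFeasible Ω That T (Matrix.vecMulVec T T) ∧
  ∀ x X, SDPEFeasible Ω That x X →
    (∑ β : Idx n, w β * Matrix.vecMulVec T T β β) ≤ (∑ β : Idx n, w β * X β β) ∧
    ((∑ β : Idx n, w β * X β β) = (∑ β : Idx n, w β * Matrix.vecMulVec T T β β) →
      x = T ∧ X = Matrix.vecMulVec T T)

/-- Feasibility for the noisy SDP relaxation (SDP-N). -/
structure SDPNFeasible {d : ℕ} {n : Fin d → ℕ}
    (x : Idx n → ℝ) (X : Matrix (Idx n) (Idx n) ℝ) : Prop where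
  isSymm : X.IsSymm
  squares : ∀ α₁ α₂ α₃ α₄ : Idx n, IsSquare α₁ α₂ α₃ α₄ → X α₁ α₂ = X α₃ α₄
  psd : (border x X).PosSemidef

/-- Objective of (SDP-N) with noisy data `Teps` and penalty constant `c`. -/
noncomputable def sdpnObj {d : ℕ} {n : Fin d → ℕ} (Ω : Finset (Idx n))
    (Teps : Idx n → ℝ) (c : ℝ) (x : Idx n → ℝ) (X : Matrix (Idx n) (Idx n) ℝ) : ℝ :=
  Matrix.trace X + c * ∑ α ∈ Ω, (X α α - 2 * Teps α * x α + Teps α ^ 2)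

/-- Optimality for (SDP-N). -/
def SDPNOptimal {d : ℕ} {n : Fin d → ℕ} (Ω : Finset (Idx n)) (Teps : Idx n → ℝ)
    (c : ℝ) (x : Idx n → ℝ) (X : Matrix (Idx n) (Idx n) ℝ) : Prop :=
  SDPNFeasible x X ∧
    ∀ y Y, SDPNFeasible y Y → sdpnObj Ω Teps c x X ≤ sdpnObj Ω Teps c y Y

/-- Frobenius norm of a square real matrix. -/
noncomputable def frob {m : Type*} [Fintype m] (A : Matrix m m ℝ) : ℝ :=
  Real.sqrt (∑ a : m, ∑ b : m, A a b ^ 2)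

/-- `‖ε‖_∞ = max_{α ∈ Ω} |ε α|`. -/
noncomputable def supNormOn {d : ℕ} {n : Fin d → ℕ} (Ω : Finset (Idx n))
    (ε : Idx n → ℝ) : ℝ :=
  ⨆ α : {a : Idx n // a ∈ Ω}, |ε (α : Idx n)|

/-- The function `χ(s) = s + √s`. -/
noncomputable def chiFn (s : ℝ) : ℝ := s + Real.sqrt s

/-! ### Polynomial (sum of squares) machinery -/

/-- `f_α = x_α - T̂_α`. -/
noncomputable def fPoly {d : ℕ} {n : Fin d → ℕ} (That : Idx n → ℝ) (α : Idx n) :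
    MvPolynomial (Idx n) ℝ :=
  MvPolynomial.X α - MvPolynomial.C (That α)

/-- `g_α = x_α² - T̂_α²`. -/
noncomputable def gPoly {d : ℕ} {n : Fin d → ℕ} (That : Idx n → ℝ) (α : Idx n) :
    MvPolynomial (Idx n) ℝ :=
  MvPolynomial.X α ^ 2 - MvPolynomial.C (That α ^ 2)

/-- Sums of squares of polynomials. -/
def IsSOS {d : ℕ} {n : Fin d → ℕ} (p : MvPolynomial (Idx n) ℝ) : Prop :=
  ∃ (k : ℕ) (q : Fin k → MvPolynomial (Idx n) ℝ), p = ∑ i : Fin k, q i ^ 2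

/-- `Σ_{N,2}`: sums of squares of degree at most 2. -/
def SigmaN2 {d : ℕ} {n : Fin d → ℕ} (p : MvPolynomial (Idx n) ℝ) : Prop :=
  IsSOS p ∧ p.totalDegree ≤ 2

/-- The truncated ideal `I₂`, the span of the `f_α` and `g_α` for `α ∈ Ω`. -/
noncomputable def I2span {d : ℕ} {n : Fin d → ℕ} (Ω : Set (Idx n)) (That : Idx n → ℝ) :
    Submodule ℝ (MvPolynomial (Idx n) ℝ) :=
  Submodule.span ℝ
    ({p | ∃ α ∈ Ω, p = fPoly That α} ∪ {p | ∃ α ∈ Ω, p = gPoly That α})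

/-- The truncated ideal `J₂`, the span of the square relations. -/
noncomputable def J2span {d : ℕ} (n : Fin d → ℕ) : Submodule ℝ (MvPolynomial (Idx n) ℝ) :=
  Submodule.span ℝ
    {p | ∃ a b c e : Idx n, IsSquare a b c e ∧
      p = MvPolynomial.X a * MvPolynomial.X b - MvPolynomial.X c * MvPolynomial.X e}

/-- The quadratic polynomial `[1;x]ᵀ Q [1;x]` associated to a matrix `Q ∈ 𝕊^{N+1}`. -/
noncomputable def gramPoly {d : ℕ} {n : Fin d → ℕ}
    (Q : Matrix (Option (Idx n)) (Option (Idx n)) ℝ) : MvPolynomial (Idx n) ℝ :=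
  ∑ a : Option (Idx n), ∑ b : Option (Idx n),
    MvPolynomial.C (Q a b) * (Option.elim a 1 MvPolynomial.X) *
      (Option.elim b 1 MvPolynomial.X)

/-! ### Dual of the noisy SDP -/

/-- The trace inner product `A • B` of two matrices. -/
noncomputable def dotM {m : Type*} [Fintype m] (A B : Matrix m m ℝ) : ℝ :=
  ∑ a : m, ∑ b : m, A a b * B a b

/-- The indicator vector `e_α`, padded with a zero at the extra index. -/
def indVec {d : ℕ} {n : Fin d → ℕ} (α : Idx n) : Option (Idx n) → ℝ :=
  fun o => if o = some α then 1 else 0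

/-- The matrix `A_α = [-T^ε_α; e_α][-T^ε_α; e_α]ᵀ`. -/
noncomputable def Amat {d : ℕ} {n : Fin d → ℕ} (Teps : Idx n → ℝ) (α : Idx n) :
    Matrix (Option (Idx n)) (Option (Idx n)) ℝ :=
  Matrix.vecMulVec (fun o => Option.elim o (-Teps α) (fun β => if β = α then 1 else 0))
    (fun o => Option.elim o (-Teps α) (fun β => if β = α then 1 else 0))

/-- The (padded) matrix `E_{α,β} = e_α e_βᵀ + e_β e_αᵀ`. -/
noncomputable def Ebig {d : ℕ} {n : Fin d → ℕ} (a b : Idx n) :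
    Matrix (Option (Idx n)) (Option (Idx n)) ℝ :=
  Matrix.vecMulVec (indVec a) (indVec b) + Matrix.vecMulVec (indVec b) (indVec a)

/-- The matrix `[[1,0],[0,0]]`. -/
def E00 {d : ℕ} {n : Fin d → ℕ} : Matrix (Option (Idx n)) (Option (Idx n)) ℝ :=
  Matrix.of fun a b => if a = none ∧ b = none then 1 else 0

/-- The matrix `[[0,0],[0,I_N]]`. -/
def Ibot {d : ℕ} {n : Fin d → ℕ} : Matrix (Option (Idx n)) (Option (Idx n)) ℝ :=
  1 - E00

open Classical in
/-- The dual slack matrix of (dSDP-N) associated to data `(ρ, μ)`. -/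
noncomputable def dualNMatrix {d : ℕ} {n : Fin d → ℕ} (Ω : Finset (Idx n))
    (Teps : Idx n → ℝ) (c ρ : ℝ) (μ : Idx n → Idx n → Idx n → Idx n → ℝ) :
    Matrix (Option (Idx n)) (Option (Idx n)) ℝ :=
  Ibot - ρ • E00 + c • (∑ α ∈ Ω, Amat Teps α) -
    ∑ a : Idx n, ∑ b : Idx n, ∑ cc : Idx n, ∑ e : Idx n,
      (if IsSquare a b cc e then (μ a b cc e / 2) • (Ebig a b - Ebig cc e) else 0)

/-- Dual feasibility for (dSDP-N): `Q` is PSD and has the prescribed dual form. -/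
def DualNFeasible {d : ℕ} {n : Fin d → ℕ} (Ω : Finset (Idx n)) (Teps : Idx n → ℝ)
    (c : ℝ) (Q : Matrix (Option (Idx n)) (Option (Idx n)) ℝ) : Prop :=
  Q.PosSemidef ∧ ∃ (ρ : ℝ) (μ : Idx n → Idx n → Idx n → Idx n → ℝ),
    Q = dualNMatrix Ω Teps c ρ μ

/-! ### Level-based weights (Algorithm 1) -/

/-- Cumulative level sets: level 0 is `𝒫_SR(Ω)`; each next level adds the tuples
completing a square with three previously reached tuples. -/
def srLevelSet {d : ℕ} {n : Fin d → ℕ} (Ω : Set (Idx n)) : ℕ → Set (Idx n)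
  | 0 => {β | PSR Ω β}
  | (ℓ + 1) => srLevelSet Ω ℓ ∪ {β | ∃ a b c : Idx n,
      a ∈ srLevelSet Ω ℓ ∧ b ∈ srLevelSet Ω ℓ ∧ c ∈ srLevelSet Ω ℓ ∧ IsSquare a b c β}

/-- The level-based weight vector `w(ϑ)`: `w(ϑ)_β = ϑ^ℓ` where `ℓ` is the first level
containing `β`. -/
noncomputable def levelWeight {d : ℕ} {n : Fin d → ℕ} (Ω : Set (Idx n)) (θ : ℝ)
    (β : Idx n) : ℝ :=
  θ ^ sInf {ℓ : ℕ | β ∈ srLevelSet Ω ℓ}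

/-! ### Random masks -/

/-- The Bernoulli measure on `Bool` with success probability `p`. -/
noncomputable def bern (p : ℝ) : Measure Bool :=
  (ENNReal.ofReal p) • Measure.dirac true + (ENNReal.ofReal (1 - p)) • Measure.dirac false

section Helpers

variable {d : ℕ} {n : Fin d → ℕ}

/-- The degree-two moment functional sending `1 ↦ 1`, `X a ↦ x a`, and `X a * X b ↦ X a b`
for symmetric `X`. -/
noncomputable def momentFunctional (x : Idx n → ℝ) (X : Matrix (Idx n) (Idx n) ℝ) :
    MvPolynomial (Idx n) ℝ →ₗ[ℝ] ℝ :=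
  let ev : MvPolynomial (Idx n) ℝ →ₗ[ℝ] ℝ := (MvPolynomial.aeval (0 : Idx n → ℝ)).toLinearMap
  ev + ∑ a, x a • (ev ∘ₗ (MvPolynomial.pderiv a).toLinearMap) +
    ∑ a, ∑ b, (X a b / 2) •
      (ev ∘ₗ (MvPolynomial.pderiv a).toLinearMap ∘ₗ (MvPolynomial.pderiv b).toLinearMap)

lemma momentFunctional_one (x : Idx n → ℝ) (X : Matrix (Idx n) (Idx n) ℝ) :
    momentFunctional x X 1 = 1 := by
  simp [momentFunctional]

lemma momentFunctional_C (x : Idx n → ℝ) (X : Matrix (Idx n) (Idx n) ℝ) (r : ℝ) :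
    momentFunctional x X (MvPolynomial.C r) = r := by
  simp [momentFunctional]

lemma momentFunctional_X (x : Idx n → ℝ) (X : Matrix (Idx n) (Idx n) ℝ) (a : Idx n) :
    momentFunctional x X (MvPolynomial.X a) = x a := by
  simp [momentFunctional, MvPolynomial.pderiv_X, Pi.single_apply, apply_ite]

lemma momentFunctional_X_mul_X (x : Idx n → ℝ) {X : Matrix (Idx n) (Idx n) ℝ}
    (hX : X.IsSymm) (a b : Idx n) :
    momentFunctional x X (MvPolynomial.X a * MvPolynomial.X b) = X a b := by
  have h := hX.apply a b
  simp [momentFunctional, MvPolynomial.pderiv_X, Pi.single_apply, mul_add,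
    Finset.sum_add_distrib, apply_ite (MvPolynomial.pderiv _),
    apply_ite (MvPolynomial.constantCoeff (σ := Idx n) (R := ℝ)), h]

lemma momentFunctional_gramPoly {x : Idx n → ℝ} {X : Matrix (Idx n) (Idx n) ℝ}
    (hX : X.IsSymm) (Q : Matrix (Option (Idx n)) (Option (Idx n)) ℝ) :
    momentFunctional x X (gramPoly Q) = dotM Q (border x X) := by
  simp only [gramPoly, dotM, map_sum]
  refine Finset.sum_congr rfl fun a _ => Finset.sum_congr rfl fun b _ => ?_
  rw [mul_assoc, ← MvPolynomial.smul_eq_C_mul, map_smul, smul_eq_mul]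
  congr 1
  cases a <;> cases b <;>
    simp [border, momentFunctional_one, momentFunctional_X, momentFunctional_X_mul_X x hX]

lemma momentFunctional_eq_zero {Ω : Set (Idx n)} {That x : Idx n → ℝ}
    {X : Matrix (Idx n) (Idx n) ℝ} (h : SDPEFeasible Ω That x X)
    {p : MvPolynomial (Idx n) ℝ} (hp : p ∈ I2span Ω That ⊔ J2span n) :
    momentFunctional x X p = 0 := by
  rw [← LinearMap.mem_ker]
  refine (sup_le ?_ ?_ : I2span Ω That ⊔ J2span n ≤ _) hp
  · refine Submodule.span_le.mpr ?_
    rintro _ (⟨α, hα, rfl⟩ | ⟨α, hα, rfl⟩)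
    · simp [fPoly, momentFunctional_X, momentFunctional_C, h.obs α hα]
    · rw [SetLike.mem_coe, LinearMap.mem_ker, gPoly, map_sub, pow_two (MvPolynomial.X α),
        momentFunctional_X_mul_X x h.isSymm, momentFunctional_C, h.obsDiag α hα, sub_self]
  · refine Submodule.span_le.mpr ?_
    rintro _ ⟨a, b, c, e, hs, rfl⟩
    simp [momentFunctional_X_mul_X x h.isSymm, h.squares a b c e hs]

lemma dotM_eq_trace_sub {Ω : Set (Idx n)} {That T x : Idx n → ℝ}
    {X : Matrix (Idx n) (Idx n) ℝ} (h : SDPEFeasible Ω That x X)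
    {Q : Matrix (Option (Idx n)) (Option (Idx n)) ℝ}
    (hmod : (∑ β : Idx n, (MvPolynomial.X β ^ 2 - MvPolynomial.C (T β ^ 2))) - gramPoly Q
        ∈ I2span Ω That ⊔ J2span n) :
    dotM Q (border x X) = Matrix.trace X - Matrix.trace (Matrix.vecMulVec T T) := by
  have h0 := momentFunctional_eq_zero h hmod
  rw [map_sub, momentFunctional_gramPoly h.isSymm, map_sum, sub_eq_zero] at h0
  rw [← h0, Matrix.trace, Matrix.trace, ← Finset.sum_sub_distrib]
  refine Finset.sum_congr rfl fun β _ => ?_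
  rw [map_sub, momentFunctional_C, pow_two (MvPolynomial.X β),
    momentFunctional_X_mul_X x h.isSymm]
  simp [Matrix.vecMulVec_apply, pow_two]

lemma dotM_conjTranspose_mul_self {m : Type*} [Fintype m] (B M : Matrix m m ℝ) :
    dotM (B.conjTranspose * B) M = ∑ k, star (B.row k) ⬝ᵥ M.mulVec (B.row k) := by
  simp only [dotM, Matrix.mul_apply, Matrix.row_apply, dotProduct, Matrix.mulVec, Matrix.conjTranspose_apply,
    Pi.star_apply, star_trivial, Finset.sum_mul, Finset.mul_sum]
  rw [Finset.sum_congr rfl fun a _ => Finset.sum_comm, Finset.sum_comm]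
  refine Finset.sum_congr rfl fun k _ => Finset.sum_congr rfl fun a _ =>
    Finset.sum_congr rfl fun b _ => by ring

open scoped MatrixOrder in
lemma dotM_nonneg {m : Type*} [Fintype m] {Q M : Matrix m m ℝ}
    (hQ : Q.PosSemidef) (hM : M.PosSemidef) : 0 ≤ dotM Q M := by
  classical
  obtain ⟨B, hB⟩ := CStarAlgebra.nonneg_iff_eq_star_mul_self.mp hQ.nonneg
  rw [Matrix.star_eq_conjTranspose] at hB
  subst hB
  rw [dotM_conjTranspose_mul_self]
  exact Finset.sum_nonneg fun k _ => hM.dotProduct_mulVec_nonneg _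

open scoped MatrixOrder in
lemma mul_eq_zero_of_dotM_eq_zero {m : Type*} [Fintype m] {Q M : Matrix m m ℝ}
    (hQ : Q.PosSemidef) (hM : M.PosSemidef) (h : dotM Q M = 0) : Q * M = 0 := by
  classical
  obtain ⟨B, hB⟩ := CStarAlgebra.nonneg_iff_eq_star_mul_self.mp hQ.nonneg
  rw [Matrix.star_eq_conjTranspose] at hB
  subst hB
  rw [dotM_conjTranspose_mul_self,
    Finset.sum_eq_zero_iff_of_nonneg fun k _ => hM.dotProduct_mulVec_nonneg _] at h
  have hBM : B * M = 0 := by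
    ext k b
    have := congrFun ((hM.dotProduct_mulVec_zero_iff _).mp (h k (Finset.mem_univ k))) b
    refine Eq.trans ?_ this
    rw [Matrix.mul_apply, Matrix.mulVec, dotProduct]
    refine Finset.sum_congr rfl fun a _ => ?_
    rw [mul_comm, ← hM.isHermitian.apply, star_trivial, Matrix.row_apply]
  rw [Matrix.mul_assoc, hBM, Matrix.mul_zero]

lemma border_vecMulVec (T : Idx n → ℝ) :
    border T (Matrix.vecMulVec T T) =
      Matrix.vecMulVec (fun o => Option.elim o 1 T) (fun o => Option.elim o 1 T) := by
  ext a b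
  cases a <;> cases b <;> simp [border, Matrix.vecMulVec_apply]

lemma IsRankOne.mul_eq_mul {T : Idx n → ℝ} (hT : IsRankOne T) {a b c e : Idx n}
    (h : IsSquare a b c e) : T a * T b = T c * T e := by
  obtain ⟨u, hu⟩ := hT
  simp only [hu, ← Finset.prod_mul_distrib]
  refine Finset.prod_congr rfl fun k _ => ?_
  obtain ⟨h₁, h₂⟩ := h.2 k
  rcases le_total (a k) (b k) with hab | hab <;> rcases le_total (c k) (e k) with hce | hce <;>
    simp only [max_eq_left, max_eq_right, min_eq_left, min_eq_right, hab, hce] at h₁ h₂ <;>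
    rw [h₁, h₂] <;> ring

lemma IsRankOne.feasible {Ω : Set (Idx n)} {That T : Idx n → ℝ} (hT : IsRankOne T)
    (hTm : ∀ α ∈ Ω, T α = That α) : SDPEFeasible Ω That T (Matrix.vecMulVec T T) where
  isSymm := Matrix.IsSymm.ext fun a b => mul_comm _ _
  obs := hTm
  obsDiag α hα := by rw [Matrix.vecMulVec_apply, hTm α hα, pow_two]
  squares _ _ _ _ h := hT.mul_eq_mul h
  psd := by
    rw [border_vecMulVec]
    simpa using Matrix.posSemidef_vecMulVec_self_star
      (fun o : Option (Idx n) => Option.elim o (1 : ℝ) T)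

/-- A square matrix of corank one has kernel spanned by any nonzero kernel vector. -/
lemma exists_smul_eq_of_mulVec_eq_zero {m : Type*} [Fintype m] {Q : Matrix m m ℝ}
    (hQ : Q.rank + 1 = Fintype.card m) {v w : m → ℝ} (hv₀ : v ≠ 0)
    (hv : Q.mulVec v = 0) (hw : Q.mulVec w = 0) : ∃ c : ℝ, c • v = w := by
  classical
  have hker : Module.finrank ℝ (LinearMap.ker Q.mulVecLin) = 1 := by
    have := Q.mulVecLin.finrank_range_add_finrank_ker
    rw [Module.finrank_fintype_fun_eq_card] at this
    rw [Matrix.rank] at hQ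
    omega
  have hne : (⟨v, hv⟩ : LinearMap.ker Q.mulVecLin) ≠ 0 := fun h => hv₀ (congrArg Subtype.val h)
  obtain ⟨c, hc⟩ := (finrank_eq_one_iff_of_nonzero' _ hne).mp hker ⟨w, hw⟩
  exact ⟨c, congrArg Subtype.val hc⟩

end Helpers

/-- If `Σ_β (x_β² - T_β²) = σ mod (I₂ + J₂)` for some SOS `σ` with a
Gram matrix of rank `N`, then the relaxation (SDP-E) is tight. -/
theorem statement13 {d : ℕ} {n : Fin d → ℕ} (Ω : Set (Idx n)) (That : Idx n → ℝ)
    (T : Idx n → ℝ) (hT : IsRankOne T) (hTm : ∀ α ∈ Ω, T α = That α)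
    (huniq : ∀ T' : Idx n → ℝ, IsRankOne T' → (∀ α ∈ Ω, T' α = That α) → T' = T)
    (σ : MvPolynomial (Idx n) ℝ) (hσ : SigmaN2 σ)
    (Q : Matrix (Option (Idx n)) (Option (Idx n)) ℝ)
    (hQpsd : Q.PosSemidef) (hQgram : σ = gramPoly Q)
    (hQrank : Q.rank = Fintype.card (Idx n))
    (hmod : (∑ β : Idx n, (MvPolynomial.X β ^ 2 - MvPolynomial.C (T β ^ 2))) - σ
        ∈ I2span Ω That ⊔ J2span n) :
    SDPETight Ω That T := by
  have hfeas := hT.feasible hTm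
  subst hQgram
  refine ⟨hfeas, fun x X h => ⟨?_, fun htr => ?_⟩⟩
  · have := dotM_nonneg hQpsd h.psd
    rw [dotM_eq_trace_sub h hmod] at this
    linarith
  · have hQT := mul_eq_zero_of_dotM_eq_zero hQpsd hfeas.psd
      (by rw [dotM_eq_trace_sub hfeas hmod, sub_self])
    have hQX := mul_eq_zero_of_dotM_eq_zero hQpsd h.psd
      (by rw [dotM_eq_trace_sub h hmod, htr, sub_self])
    have hcol (b : Option (Idx n)) : ∃ c : ℝ, c • (border T (Matrix.vecMulVec T T)).col none =
        (border x X).col b := by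
      refine exists_smul_eq_of_mulVec_eq_zero (Q := Q) ?_ ?_ ?_ ?_
      · rw [hQrank, Fintype.card_option]
      · exact fun h0 => one_ne_zero (congrFun h0 none)
      · exact funext fun i => congrFun (congrFun hQT i) none
      · exact funext fun i => congrFun (congrFun hQX i) b
    have hxT : x = T := by
      obtain ⟨c, hc⟩ := hcol none
      have h1 : c = 1 := by simpa [border] using congrFun hc none
      ext α
      simpa [border, h1] using (congrFun hc (some α)).symm
    refine ⟨hxT, ?_⟩
    ext α β
    obtain ⟨c, hc⟩ := hcol (some β)
    have h1 : c = x β := by simpa [border] using congrFun hc none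
    have h2 : c * T α = X α β := by simpa [border] using congrFun hc (some α)
    rw [← h2, h1, hxT, Matrix.vecMulVec_apply, mul_comm]


end RankOneTC
end

section
/- Assume Ω satisfies SR-propagation, the noiseless observed values T̂_α are nonzero for all α ∈ Ω, and T ∈ ℝ^⟦N⟧ is the unique rank-one completion with matrix 𝐗̄. Let χ(s) := s + √s. Then there exists a constant K > 0 (depending only on Ω and T̂) such that for every noise vector ε ∈ ℝ^Ω and every penalty parameter C > 0, every optimal solution 𝐗_c^ε of the noisy relaxation (SDP-N) with data T^ε := T̂ + ε satisfies ‖𝐗̄ − 𝐗_c^ε‖_F ≤ K · χ(‖ε‖_∞ + ‖ε‖_∞²·C + 1/C). In particular, taking C = 1/‖ε‖_∞ gives an error bound of order √(‖ε‖_∞) as ‖ε‖_∞ → 0. -/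
namespace RankOneTC

open scoped BigOperators
open MeasureTheory

/-- Squares are respected by products of entries of a rank-one tensor. -/
theorem IsRankOne.mul_eq_mul_of_isSquare {d : ℕ} {n : Fin d → ℕ} {T : Idx n → ℝ}
    (hT : IsRankOne T) {a b a' b' : Idx n} (h : IsSquare a b a' b') :
    T a * T b = T a' * T b' := by
  obtain ⟨u, hu⟩ := hT
  simp only [hu, ← Finset.prod_mul_distrib]
  refine Finset.prod_congr rfl fun k _ => ?_
  obtain ⟨h1, h2⟩ := h.2 k
  rcases le_total (a k) (b k) with hab | hab <;> rcases le_total (a' k) (b' k) with hab' | hab' <;>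
    simp_all [mul_comm]

theorem border_vecMulVec_eq {d : ℕ} {n : Fin d → ℕ} (T : Idx n → ℝ) :
    border T (Matrix.vecMulVec T T) =
      Matrix.vecMulVec (fun o : Option (Idx n) => o.elim 1 T) (fun o => o.elim 1 T) := by
  ext a b
  cases a <;> cases b <;> simp [border, Matrix.vecMulVec_apply]

/-- The moment matrix of a rank-one tensor is feasible for (SDP-N). -/
theorem IsRankOne.sdpnFeasible {d : ℕ} {n : Fin d → ℕ} {T : Idx n → ℝ} (hT : IsRankOne T) :
    SDPNFeasible T (Matrix.vecMulVec T T) where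
  isSymm := by
    ext a b
    simp [Matrix.vecMulVec_apply, mul_comm]
  squares a b a' b' h := by
    simpa [Matrix.vecMulVec_apply] using hT.mul_eq_mul_of_isSquare h
  psd := by
    rw [border_vecMulVec_eq]
    simpa using Matrix.posSemidef_vecMulVec_self_star (fun o : Option (Idx n) => o.elim (1 : ℝ) T)

/-- The `2 × 2` minors of a real positive semidefinite matrix are nonnegative. -/
theorem posSemidef_sq_le_mul_diag {m : Type*} [Fintype m] {A : Matrix m m ℝ}
    (hA : A.PosSemidef) (a b : m) : A a b ^ 2 ≤ A a a * A b b := by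
  classical
  have hsymm : A b a = A a b := by simpa using hA.isHermitian.apply a b
  have h := discrim_le_zero (a := A a a) (b := 2 * A a b) (c := A b b) fun t => by
    have := hA.dotProduct_mulVec_nonneg (Pi.single a t + Pi.single b 1)
    simp [Matrix.mulVec_add, hsymm] at this
    linarith
  rw [discrim] at h
  linarith

/-- The Schur complement of the corner entry of a positive semidefinite bordered matrix. -/
theorem posSemidef_sub_vecMulVec_of_border {d : ℕ} {n : Fin d → ℕ} {x : Idx n → ℝ}
    {X : Matrix (Idx n) (Idx n) ℝ} (h : (border x X).PosSemidef) :
    (X - Matrix.vecMulVec x x).PosSemidef := by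
  have hsymm : ∀ a b, X b a = X a b := fun a b => by
    simpa [border] using h.isHermitian.apply (some a) (some b)
  refine Matrix.PosSemidef.of_dotProduct_mulVec_nonneg ?_ fun v => ?_
  · ext a b
    simp [Matrix.vecMulVec_apply, hsymm a b, mul_comm]
  · have := h.dotProduct_mulVec_nonneg (fun o => o.elim (-(x ⬝ᵥ v)) v)
    simp only [dotProduct, Matrix.mulVec, Fintype.sum_option, border, Matrix.of_apply, star_trivial,
      Option.elim_none, Option.elim_some, Matrix.sub_apply, Matrix.vecMulVec_apply] at this ⊢
    set q := ∑ i, x i * v i with hq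
    have e : ∀ i, v i * ∑ j, (X i j - x i * x j) * v j =
        v i * ∑ j, X i j * v j - x i * v i * q := fun i => by
      simp only [sub_mul, Finset.sum_sub_distrib, mul_assoc, ← Finset.mul_sum, ← hq]
      ring
    have e' : ∀ i, v i * (x i * -q + ∑ j, X i j * v j) =
        v i * ∑ j, X i j * v j - x i * v i * q := fun i => by ring
    simp only [e, e', Finset.sum_sub_distrib, ← Finset.sum_mul, ← hq] at this ⊢
    linarith

theorem frob_le_card_mul {m : Type*} [Fintype m] {A : Matrix m m ℝ} {B : ℝ} (hB : 0 ≤ B)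
    (h : ∀ a b, |A a b| ≤ B) : frob A ≤ Fintype.card m * B := by
  refine Real.sqrt_le_iff.2 ⟨by positivity, ?_⟩
  calc ∑ a, ∑ b, A a b ^ 2 ≤ ∑ _a : m, ∑ _b : m, B ^ 2 :=
        Finset.sum_le_sum fun a _ => Finset.sum_le_sum fun b _ => sq_le_sq' (abs_le.1 (h a b)).1
          (abs_le.1 (h a b)).2
    _ = (Fintype.card m * B) ^ 2 := by simp; ring

theorem abs_le_supNormOn {d : ℕ} {n : Fin d → ℕ} {Ω : Finset (Idx n)} (ε : Idx n → ℝ)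
    {α : Idx n} (hα : α ∈ Ω) : |ε α| ≤ supNormOn Ω ε :=
  le_ciSup (f := fun α : {a : Idx n // a ∈ Ω} => |ε (α : Idx n)|) (Set.finite_range _).bddAbove
    ⟨α, hα⟩

theorem supNormOn_nonneg {d : ℕ} {n : Fin d → ℕ} (Ω : Finset (Idx n)) (ε : Idx n → ℝ) :
    0 ≤ supNormOn Ω ε :=
  Real.iSup_nonneg fun _ => abs_nonneg _

/-- `x` and `X` satisfy the square relations, `X - x xᵀ` is positive semidefinite, the diagonal of
`X` is bounded by `M`, and on `Ω` both `x - T` and the diagonal of `X - x xᵀ` are controlled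
by `r`. -/
structure NearOn {d : ℕ} {n : Fin d → ℕ} (Ω : Finset (Idx n)) (T : Idx n → ℝ) (M r : ℝ)
    (x : Idx n → ℝ) (X : Matrix (Idx n) (Idx n) ℝ) : Prop where
  squares : ∀ a b a' b' : Idx n, IsSquare a b a' b' → X a b = X a' b'
  psd : (X - Matrix.vecMulVec x x).PosSemidef
  diag_le : ∀ a, X a a ≤ M
  schur_le : ∀ α ∈ Ω, X α α - x α ^ 2 ≤ M * r ^ 2
  abs_sub_le : ∀ α ∈ Ω, |x α - T α| ≤ (1 + M) * r

theorem schur_sq_le {d : ℕ} {n : Fin d → ℕ} {x : Idx n → ℝ} {X : Matrix (Idx n) (Idx n) ℝ}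
    (h : (X - Matrix.vecMulVec x x).PosSemidef) (a b : Idx n) :
    (X a b - x a * x b) ^ 2 ≤ (X a a - x a ^ 2) * (X b b - x b ^ 2) := by
  simpa [Matrix.vecMulVec_apply, sq] using posSemidef_sq_le_mul_diag h a b

theorem sq_le_diag {d : ℕ} {n : Fin d → ℕ} {x : Idx n → ℝ} {X : Matrix (Idx n) (Idx n) ℝ}
    (h : (X - Matrix.vecMulVec x x).PosSemidef) (a : Idx n) : x a ^ 2 ≤ X a a := by
  simpa [Matrix.vecMulVec_apply, sq] using h.diag_nonneg (i := a)

namespace NearOn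

variable {d : ℕ} {n : Fin d → ℕ} {Ω : Finset (Idx n)} {T : Idx n → ℝ} {M r : ℝ}
  {x : Idx n → ℝ} {X : Matrix (Idx n) (Idx n) ℝ}

theorem abs_le (h : NearOn Ω T M r x X) (hM : 1 ≤ M) (a : Idx n) : |x a| ≤ M :=
  abs_le_of_sq_le_sq (by nlinarith [sq_le_diag h.psd a, h.diag_le a]) (by linarith)

theorem abs_schur_le (h : NearOn Ω T M r x X) (hM : 1 ≤ M) (hr : 0 ≤ r) {α : Idx n}
    (hα : α ∈ Ω) (b : Idx n) : |X α b - x α * x b| ≤ M * r := by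
  refine abs_le_of_sq_le_sq ((schur_sq_le h.psd α b).trans ?_) (by positivity)
  have h1 : X b b - x b ^ 2 ≤ M := by nlinarith [h.diag_le b]
  calc _ ≤ (M * r ^ 2) * M := mul_le_mul (h.schur_le α hα) h1
        (by linarith [sq_le_diag h.psd b]) (by positivity)
    _ = (M * r) ^ 2 := by ring

/-- Closeness on `Ω` spreads along SR-propagation. -/
theorem exists_abs_sub_le (hM : 1 ≤ M) (hT : IsRankOne T) (hnz : ∀ α ∈ Ω, T α ≠ 0)
    {β : Idx n} (hβ : PSR (↑Ω : Set (Idx n)) β) :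
    ∃ K : ℝ, 0 ≤ K ∧ ∀ (r : ℝ) (x : Idx n → ℝ) (X : Matrix (Idx n) (Idx n) ℝ), 0 ≤ r →
      NearOn Ω T M r x X → |x β - T β| ≤ K * r := by
  induction hβ with
  | base hα => exact ⟨1 + M, by linarith, fun r x X _ h => h.abs_sub_le _ hα⟩
  | @prop α₁ β α₂ γ hsq h1 h2 _ ih =>
    obtain ⟨K, hK, ih⟩ := ih
    have hpos : 0 < |T α₂| := abs_pos.2 (hnz _ h2)
    refine ⟨(2 * ((1 + M) * M) + 2 * M + |T α₁| * K) / |T α₂|, by positivity,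
      fun r x X hr h => ?_⟩
    rw [div_mul_eq_mul_div, le_div_iff₀ hpos, ← abs_mul]
    have key : (x γ - T γ) * T α₂ = (T α₂ - x α₂) * x γ - (X α₂ γ - x α₂ * x γ)
        + (X α₁ β - x α₁ * x β) + (x α₁ - T α₁) * x β + T α₁ * (x β - T β) := by
      rw [h.squares _ _ _ _ hsq]
      linear_combination hT.mul_eq_mul_of_isSquare hsq
    have e1 : |(T α₂ - x α₂) * x γ| ≤ (1 + M) * r * M := by
      rw [abs_mul, abs_sub_comm]
      exact mul_le_mul (h.abs_sub_le _ h2) (h.abs_le hM _) (abs_nonneg _) (by positivity)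
    have e2 : |(x α₁ - T α₁) * x β| ≤ (1 + M) * r * M := by
      rw [abs_mul]
      exact mul_le_mul (h.abs_sub_le _ h1) (h.abs_le hM _) (abs_nonneg _) (by positivity)
    have e3 : |T α₁ * (x β - T β)| ≤ |T α₁| * (K * r) := by
      rw [abs_mul]
      exact mul_le_mul_of_nonneg_left (ih r x X hr h) (abs_nonneg _)
    have e4 := h.abs_schur_le hM hr h2 γ
    have e5 := h.abs_schur_le hM hr h1 β
    rw [key]
    rw [_root_.abs_le] at *
    constructor <;> linarith [e1.1, e1.2]

end NearOn

/-- Comparing an optimal solution of (SDP-N) with the moment matrix of the true tensor. -/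
theorem SDPNOptimal.basic_inequality {d : ℕ} {n : Fin d → ℕ} {Ω : Finset (Idx n)}
    {T ε : Idx n → ℝ} {c : ℝ} (hc : 0 < c) (hT : IsRankOne T) {x : Idx n → ℝ}
    {X : Matrix (Idx n) (Idx n) ℝ} (h : SDPNOptimal Ω (fun α => T α + ε α) c x X) :
    ∑ a, X a a + c * ∑ α ∈ Ω, ((X α α - x α ^ 2) + (x α - T α - ε α) ^ 2) ≤
      ∑ a, T a ^ 2 + c * (Ω.card * supNormOn Ω ε ^ 2) := by
  have h1 := h.2 _ _ hT.sdpnFeasible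
  have h2 : ∑ α ∈ Ω, ε α ^ 2 ≤ Ω.card * supNormOn Ω ε ^ 2 := by
    rw [← nsmul_eq_mul]
    exact Finset.sum_le_card_nsmul _ _ _ fun α hα =>
      sq_le_sq' (_root_.abs_le.1 (abs_le_supNormOn ε hα)).1
        (_root_.abs_le.1 (abs_le_supNormOn ε hα)).2
  have e1 : sdpnObj Ω (fun α => T α + ε α) c x X =
      ∑ a, X a a + c * ∑ α ∈ Ω, ((X α α - x α ^ 2) + (x α - T α - ε α) ^ 2) := by
    simp only [sdpnObj, Matrix.trace, Matrix.diag_apply]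
    congr 2
    exact Finset.sum_congr rfl fun α _ => by ring
  have e2 : sdpnObj Ω (fun α => T α + ε α) c T (Matrix.vecMulVec T T) =
      ∑ a, T a ^ 2 + c * ∑ α ∈ Ω, ε α ^ 2 := by
    simp only [sdpnObj, Matrix.trace, Matrix.diag_apply, Matrix.vecMulVec_apply]
    congr 1
    · exact Finset.sum_congr rfl fun α _ => by ring
    · congr 1
      exact Finset.sum_congr rfl fun α _ => by ring
  rw [e1, e2] at h1
  linarith [mul_le_mul_of_nonneg_left h2 hc.le]

theorem SDPNOptimal.schur_nonneg {d : ℕ} {n : Fin d → ℕ} {Ω : Finset (Idx n)}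
    {T : Idx n → ℝ} {c : ℝ} {x : Idx n → ℝ} {X : Matrix (Idx n) (Idx n) ℝ}
    (h : SDPNOptimal Ω T c x X) (a : Idx n) : 0 ≤ X a a - x a ^ 2 :=
  sub_nonneg.2 (sq_le_diag (posSemidef_sub_vecMulVec_of_border h.1.psd) a)

theorem SDPNOptimal.diag_nonneg {d : ℕ} {n : Fin d → ℕ} {Ω : Finset (Idx n)}
    {T : Idx n → ℝ} {c : ℝ} {x : Idx n → ℝ} {X : Matrix (Idx n) (Idx n) ℝ}
    (h : SDPNOptimal Ω T c x X) (a : Idx n) : 0 ≤ X a a :=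
  (sq_nonneg _).trans (sub_nonneg.1 (h.schur_nonneg a))

section Optimal

variable {d : ℕ} {n : Fin d → ℕ} {Ω : Finset (Idx n)} {T ε : Idx n → ℝ} {c : ℝ}
  {x : Idx n → ℝ} {X : Matrix (Idx n) (Idx n) ℝ}

theorem SDPNOptimal.trace_le (hc : 0 < c) (hT : IsRankOne T)
    (h : SDPNOptimal Ω (fun α => T α + ε α) c x X) :
    ∑ a, X a a ≤ ∑ a, T a ^ 2 + Ω.card * (supNormOn Ω ε ^ 2 * c) := by
  have h1 : 0 ≤ c * ∑ α ∈ Ω, ((X α α - x α ^ 2) + (x α - T α - ε α) ^ 2) :=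
    mul_nonneg hc.le (Finset.sum_nonneg fun α _ => add_nonneg (h.schur_nonneg α) (sq_nonneg _))
  linarith [h.basic_inequality hc hT]

theorem SDPNOptimal.diag_le (hc : 0 < c) (hT : IsRankOne T)
    (h : SDPNOptimal Ω (fun α => T α + ε α) c x X) (a : Idx n) :
    X a a ≤ ∑ a, T a ^ 2 + Ω.card * (supNormOn Ω ε ^ 2 * c) :=
  (Finset.single_le_sum (f := fun a => X a a) (fun a _ => h.diag_nonneg a)
    (Finset.mem_univ a)).trans (h.trace_le hc hT)

theorem SDPNOptimal.residual_le (hc : 0 < c) (hT : IsRankOne T)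
    (h : SDPNOptimal Ω (fun α => T α + ε α) c x X) {α : Idx n} (hα : α ∈ Ω) :
    (X α α - x α ^ 2) + (x α - T α - ε α) ^ 2 ≤
      (∑ a, T a ^ 2) * (1 / c) + Ω.card * supNormOn Ω ε ^ 2 := by
  have h1 := Finset.single_le_sum
    (f := fun α => (X α α - x α ^ 2) + (x α - T α - ε α) ^ 2)
    (fun α _ => add_nonneg (h.schur_nonneg α) (sq_nonneg _)) hα
  have h2 : 0 ≤ ∑ a, X a a := Finset.sum_nonneg fun a _ => h.diag_nonneg a
  refine le_of_mul_le_mul_left ?_ hc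
  have h3 : c * (1 / c) = 1 := mul_one_div_cancel hc.ne'
  calc _ ≤ ∑ a, T a ^ 2 + c * (Ω.card * supNormOn Ω ε ^ 2) := by
        linarith [h.basic_inequality hc hT, mul_le_mul_of_nonneg_left h1 hc.le]
    _ = _ := by linear_combination -(∑ a, T a ^ 2) * h3

/-- A small noise level puts every optimal solution of (SDP-N) near `T` on `Ω`. -/
theorem SDPNOptimal.nearOn {M r : ℝ} (hc : 0 < c) (hT : IsRankOne T)
    (h : SDPNOptimal Ω (fun α => T α + ε α) c x X) (hM : ∑ a, T a ^ 2 + Ω.card + 1 ≤ M)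
    (hr0 : 0 ≤ r) (hr1 : r ≤ 1)
    (hr : supNormOn Ω ε + supNormOn Ω ε ^ 2 * c + 1 / c ≤ r ^ 2) :
    NearOn Ω T M r x X := by
  have hS0 : 0 ≤ ∑ a, T a ^ 2 := by positivity
  have hcard : (0 : ℝ) ≤ Ω.card := by positivity
  have hs0 := supNormOn_nonneg Ω ε
  have hc' : 0 < 1 / c := by positivity
  have hsc : 0 ≤ supNormOn Ω ε ^ 2 * c := by positivity
  have hrr : r ^ 2 ≤ r := by rw [sq]; exact mul_le_of_le_one_left hr0 hr1
  have hΩ : ∀ α ∈ Ω, (X α α - x α ^ 2) + (x α - T α - ε α) ^ 2 ≤ M * r ^ 2 := fun α hα => by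
    refine (h.residual_le hc hT hα).trans ?_
    have h5 : supNormOn Ω ε ^ 2 ≤ r ^ 2 := pow_le_pow_left₀ hs0 (by linarith) 2
    have h6 : 1 / c ≤ r ^ 2 := by linarith
    calc _ ≤ (∑ a, T a ^ 2) * r ^ 2 + Ω.card * r ^ 2 := by gcongr
      _ = (∑ a, T a ^ 2 + Ω.card) * r ^ 2 := by ring
      _ ≤ M * r ^ 2 := by gcongr; linarith
  refine ⟨h.1.squares, posSemidef_sub_vecMulVec_of_border h.1.psd, fun a => ?_, fun α hα => ?_,
    fun α hα => ?_⟩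
  · have : Ω.card * (supNormOn Ω ε ^ 2 * c) ≤ Ω.card * 1 := by gcongr; linarith
    linarith [h.diag_le hc hT a]
  · linarith [hΩ α hα, sq_nonneg (x α - T α - ε α)]
  · have h2 : |x α - T α - ε α| ≤ M * r := by
      refine abs_le_of_sq_le_sq ?_ (mul_nonneg (by linarith) hr0)
      calc _ ≤ M * r ^ 2 := by linarith [hΩ α hα, h.schur_nonneg α]
        _ ≤ M ^ 2 * r ^ 2 := by gcongr; nlinarith
        _ = _ := by ring
    have h3 := abs_le_supNormOn ε hα
    calc |x α - T α| = |(x α - T α - ε α) + ε α| := by ring_nf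
      _ ≤ |x α - T α - ε α| + |ε α| := abs_add_le _ _
      _ ≤ (1 + M) * r := by linarith

/-- The trivial error bound, which suffices when the noise level is not small. -/
theorem SDPNOptimal.crude_bound {M δ : ℝ} (hc : 0 < c) (hT : IsRankOne T)
    (h : SDPNOptimal Ω (fun α => T α + ε α) c x X) (hM : ∑ a, T a ^ 2 + Ω.card + 1 ≤ M)
    (hδ1 : 1 ≤ δ) (hδ : supNormOn Ω ε ^ 2 * c ≤ δ) :
    (∀ a, |T a - x a| ≤ (2 * M + 1) * δ) ∧
      ∀ a b, |T a * T b - X a b| ≤ (2 * M + 1) * δ := by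
  have hS0 : 0 ≤ ∑ a, T a ^ 2 := by positivity
  have hTS : ∀ a, T a ^ 2 ≤ ∑ a, T a ^ 2 := fun a =>
    Finset.single_le_sum (f := fun a => T a ^ 2) (fun _ _ => sq_nonneg _) (Finset.mem_univ a)
  have hcard : (0 : ℝ) ≤ Ω.card := by positivity
  have hM1 : 1 ≤ M := by linarith
  have hXM : ∀ a, X a a ≤ M * δ := fun a => by
    calc _ ≤ ∑ a, T a ^ 2 + Ω.card * δ := (h.diag_le hc hT a).trans (by gcongr)
      _ ≤ (∑ a, T a ^ 2) * δ + Ω.card * δ := by gcongr; exact le_mul_of_one_le_right hS0 hδ1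
      _ = (∑ a, T a ^ 2 + Ω.card) * δ := by ring
      _ ≤ M * δ := by gcongr; linarith
  have hXpsd : X.PosSemidef := h.1.psd.submatrix (some : Idx n → Option (Idx n))
  have hXab : ∀ a b, |X a b| ≤ M * δ := fun a b =>
    abs_le_of_sq_le_sq ((posSemidef_sq_le_mul_diag hXpsd a b).trans (by
      rw [sq]
      exact mul_le_mul (hXM a) (hXM b) (h.diag_nonneg b) (by positivity))) (by positivity)
  have hMδ : M ≤ M * δ := le_mul_of_one_le_right (by linarith) hδ1
  refine ⟨fun a => (abs_sub _ _).trans ?_, fun a b => (abs_sub _ _).trans ?_⟩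
  · have h1 : |x a| ≤ 1 + M * δ := by
      nlinarith [hXM a, h.schur_nonneg a, sq_abs (x a), sq_nonneg (|x a| - 1)]
    have h2 : |T a| ≤ M := abs_le_of_sq_le_sq (by nlinarith [hTS a]) (by linarith)
    linarith
  · have h1 : |T a * T b| ≤ M := by
      rw [abs_mul]
      nlinarith [sq_abs (T a), sq_abs (T b), hTS a, hTS b, sq_nonneg (|T a| - |T b|)]
    linarith [hXab a b]

/-- The error bound for small noise, given a bound for `x - T`. -/
theorem SDPNOptimal.fine_bound {M L r : ℝ} (hc : 0 < c) (hT : IsRankOne T)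
    (h : SDPNOptimal Ω (fun α => T α + ε α) c x X) (hM : ∑ a, T a ^ 2 + Ω.card + 1 ≤ M)
    (hr0 : 0 ≤ r) (hr : supNormOn Ω ε ^ 2 * c ≤ r) (hnear : NearOn Ω T M r x X)
    (hL : 0 ≤ L) (hx : ∀ a, |x a - T a| ≤ L * r) (a b : Idx n) :
    |T a * T b - X a b| ≤
      (Fintype.card (Idx n) * (2 * M * L) + M + 2 * M * L) * r := by
  have hS0 : 0 ≤ ∑ a, T a ^ 2 := by positivity
  have hTS : ∀ a, T a ^ 2 ≤ ∑ a, T a ^ 2 := fun a =>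
    Finset.single_le_sum (f := fun a => T a ^ 2) (fun _ _ => sq_nonneg _) (Finset.mem_univ a)
  have hcard : (0 : ℝ) ≤ Ω.card := by positivity
  have hM1 : 1 ≤ M := by linarith
  have hsc : 0 ≤ supNormOn Ω ε ^ 2 * c := by positivity
  have hTM : ∀ a, |T a| ≤ M := fun a =>
    abs_le_of_sq_le_sq (by nlinarith [hTS a]) (by linarith)
  have hxx : ∀ a b, |x a * x b - T a * T b| ≤ 2 * M * L * r := fun a b => by
    have e1 : |(x a - T a) * x b| ≤ L * r * M := by
      rw [abs_mul]
      exact mul_le_mul (hx a) (hnear.abs_le hM1 b) (abs_nonneg _) (by positivity)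
    have e2 : |T a * (x b - T b)| ≤ M * (L * r) := by
      rw [abs_mul]
      exact mul_le_mul (hTM a) (hx b) (abs_nonneg _) (by positivity)
    calc |x a * x b - T a * T b| = |(x a - T a) * x b + T a * (x b - T b)| := by ring_nf
      _ ≤ |(x a - T a) * x b| + |T a * (x b - T b)| := abs_add_le _ _
      _ ≤ 2 * M * L * r := by linarith
  have htrY : ∑ a, (X a a - x a ^ 2) ≤ (Fintype.card (Idx n) * (2 * M * L) + M) * r := by
    have h2 : ∑ a, (T a ^ 2 - x a ^ 2) ≤ Fintype.card (Idx n) * (2 * M * L * r) := by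
      rw [← nsmul_eq_mul]
      refine Finset.sum_le_card_nsmul _ _ _ fun a _ => ?_
      linarith [(abs_le.1 (hxx a a)).1, sq (T a), sq (x a)]
    have h3 : Ω.card * (supNormOn Ω ε ^ 2 * c) ≤ M * r :=
      mul_le_mul (by linarith) hr hsc (by linarith)
    rw [Finset.sum_sub_distrib] at h2 ⊢
    linarith [h.trace_le hc hT]
  have hYd : ∀ a, X a a - x a ^ 2 ≤ (Fintype.card (Idx n) * (2 * M * L) + M) * r := fun a =>
    (Finset.single_le_sum (f := fun a => X a a - x a ^ 2)
      (fun a _ => h.schur_nonneg a) (Finset.mem_univ a)).trans htrY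
  have hY : |X a b - x a * x b| ≤ (Fintype.card (Idx n) * (2 * M * L) + M) * r :=
    abs_le_of_sq_le_sq ((schur_sq_le hnear.psd a b).trans (by
      rw [sq (_ * r)]
      exact mul_le_mul (hYd a) (hYd b) (h.schur_nonneg b) (by positivity))) (by positivity)
  rw [abs_sub_comm]
  calc |X a b - T a * T b| = |(X a b - x a * x b) + (x a * x b - T a * T b)| := by ring_nf
    _ ≤ |X a b - x a * x b| + |x a * x b - T a * T b| := abs_add_le _ _
    _ ≤ _ := add_le_add hY (hxx a b)
    _ = _ := by ring

end Optimal

/-- Under SR-propagation, every optimal solution of the noisy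
relaxation (SDP-N) is within `K·χ(‖ε‖_∞ + ‖ε‖_∞²·C + 1/C)` of `𝐗̄` in Frobenius
norm, where `χ(s) = s + √s`. -/
theorem statement15 {d : ℕ} {n : Fin d → ℕ} (Ω : Finset (Idx n)) (That : Idx n → ℝ)
    (hSR : SRPropagation (↑Ω : Set (Idx n))) (hnz : ∀ α ∈ Ω, That α ≠ 0)
    (T : Idx n → ℝ) (hT : IsRankOne T) (hTm : ∀ α ∈ Ω, T α = That α)
    (huniq : ∀ T' : Idx n → ℝ, IsRankOne T' → (∀ α ∈ Ω, T' α = That α) → T' = T) :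
    ∃ K : ℝ, 0 < K ∧ ∀ (ε : Idx n → ℝ) (c : ℝ), 0 < c →
      ∀ (x : Idx n → ℝ) (X : Matrix (Idx n) (Idx n) ℝ),
        SDPNOptimal Ω (fun α => That α + ε α) c x X →
          frob (border T (Matrix.vecMulVec T T) - border x X) ≤
            K * chiFn (supNormOn Ω ε + supNormOn Ω ε ^ 2 * c + 1 / c) := by
  obtain ⟨M, hM⟩ : ∃ M : ℝ, ∑ a, T a ^ 2 + Ω.card + 1 ≤ M := ⟨_, le_rfl⟩
  have hTnz : ∀ α ∈ Ω, T α ≠ 0 := fun α hα => hTm α hα ▸ hnz α hα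
  have hM1 : 1 ≤ M := le_trans (le_add_of_nonneg_left (by positivity)) hM
  choose K hK0 hK using fun β => NearOn.exists_abs_sub_le hM1 hT hTnz (hSR β)
  obtain ⟨L, hL0, hKL⟩ : ∃ L : ℝ, 0 ≤ L ∧ ∀ β, K β ≤ L :=
    ⟨∑ β, K β, Finset.sum_nonneg fun β _ => hK0 β, fun β =>
      Finset.single_le_sum (f := K) (fun β _ => hK0 β) (Finset.mem_univ β)⟩
  set D : ℝ := Fintype.card (Idx n) * (2 * M * L) + M + 2 * M * L with hD
  have hD0 : 0 ≤ D := by positivity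
  clear_value D
  obtain ⟨B, hB0, hMB, hLB, hDB⟩ : ∃ B : ℝ, 0 < B ∧ 2 * M + 1 ≤ B ∧ L ≤ B ∧ D ≤ B :=
    ⟨2 * M + 1 + L + D, by positivity, by linarith, by linarith, by linarith⟩
  refine ⟨Fintype.card (Option (Idx n)) * B, mul_pos (Nat.cast_pos.2 Fintype.card_pos) hB0,
    fun ε c hc x X hopt => ?_⟩
  have hopt' : SDPNOptimal Ω (fun α => T α + ε α) c x X := by
    have e : ∀ y Y, sdpnObj Ω (fun α => T α + ε α) c y Y =
        sdpnObj Ω (fun α => That α + ε α) c y Y := fun y Y => by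
      simp only [sdpnObj]
      congr 2
      exact Finset.sum_congr rfl fun α hα => by rw [hTm α hα]
    exact ⟨hopt.1, fun y Y hy => by rw [e, e]; exact hopt.2 y Y hy⟩
  have hs0 : 0 ≤ supNormOn Ω ε := supNormOn_nonneg Ω ε
  have hc' : 0 < 1 / c := by positivity
  have hsc : 0 ≤ supNormOn Ω ε ^ 2 * c := by positivity
  obtain ⟨δ, hδ⟩ : ∃ δ, δ = supNormOn Ω ε + supNormOn Ω ε ^ 2 * c + 1 / c := ⟨_, rfl⟩
  have hδ0 : 0 ≤ δ := by linarith
  have hδχ : δ ≤ chiFn δ := le_add_of_nonneg_right (Real.sqrt_nonneg δ)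
  have hrχ : √δ ≤ chiFn δ := le_add_of_nonneg_left hδ0
  have hχ0 : 0 ≤ chiFn δ := hδ0.trans hδχ
  rw [← hδ, mul_assoc]
  refine frob_le_card_mul (mul_nonneg hB0.le hχ0) ?_
  suffices hsuff : (∀ a, |T a - x a| ≤ B * chiFn δ) ∧
      ∀ a b, |T a * T b - X a b| ≤ B * chiFn δ by
    rintro (_ | a) (_ | b)
    · simpa [border] using mul_nonneg hB0.le hχ0
    · simpa [border] using hsuff.1 b
    · simpa [border] using hsuff.1 a
    · simpa [border, Matrix.vecMulVec_apply] using hsuff.2 a b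
  rcases le_total 1 δ with h1 | h1
  · obtain ⟨hx, hX⟩ := hopt'.crude_bound hc hT hM h1 (by linarith)
    have hle := mul_le_mul hMB hδχ hδ0 hB0.le
    exact ⟨fun a => (hx a).trans hle, fun a b => (hX a b).trans hle⟩
  · have hr0 : 0 ≤ √δ := Real.sqrt_nonneg δ
    have hr2 : √δ ^ 2 = δ := Real.sq_sqrt hδ0
    have hr1 : √δ ≤ 1 := Real.sqrt_le_one.2 h1
    have hδr : δ ≤ √δ := by nlinarith
    have hnear := hopt'.nearOn hc hT hM hr0 hr1 (by rw [hr2, hδ])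
    have hx : ∀ a, |x a - T a| ≤ L * √δ := fun a =>
      (hK a _ x X hr0 hnear).trans (mul_le_mul_of_nonneg_right (hKL a) hr0)
    refine ⟨fun a => ?_, fun a b => ?_⟩
    · rw [abs_sub_comm]
      exact (hx a).trans (mul_le_mul hLB hrχ hr0 hB0.le)
    · refine (hopt'.fine_bound hc hT hM hr0 (by linarith) hnear hL0 hx a b).trans ?_
      rw [← hD]
      exact mul_le_mul hDB hrχ hr0 hB0.le

end RankOneTC
end

section
/- Assume Ω satisfies GS-propagation, all observed values are nonzero, and T ∈ ℝ^⟦N⟧ is the unique rank-one completion. Then for every β ∈ ⟦N⟧ ∖ Ω and every real constant c_β there exist a set S_β ⊆ ⟦N⟧, nonnegative weights w_γ^{(β)} for γ ∈ S_β, and p̃_β ∈ Σ_{N,2} such that (x_β² − T_β²) + Σ_{γ∈S_β} w_γ^{(β)} (x_γ² − T_γ²) = −2c_β(x_β − T_β) + p̃_β mod (I_2 + J_2). -/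
namespace RankOneTC

open scoped BigOperators
open MeasureTheory

/-! ### Cones closed under squares -/

/-- Let `M` be a cone containing the squares of the elements of `D`. On the `y ∈ D` with
`1 - y² ∈ M`, the relation `y * z = 1` modulo the lineality space of `M` is transitive. -/
theorem mul_sub_one_mem_lineal {A : Type*} [CommRing A] [Algebra ℝ A] {M : PointedCone ℝ A}
    {D : Submodule ℝ A} (hD : ∀ q ∈ D, q ^ 2 ∈ M) {p q r : A}
    (hpD : p ∈ D) (hqD : q ∈ D) (hrD : r ∈ D)
    (hp : 1 - p ^ 2 ∈ M) (hq : 1 - q ^ 2 ∈ M) (hr : 1 - r ^ 2 ∈ M)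
    (hpq : p * q - 1 ∈ M.lineal) (hpr : p * r - 1 ∈ M.lineal) :
    q * r - 1 ∈ M.lineal := by
  have two {x : A} (hx : x ∈ M) : 2 * x ∈ M := by
    rw [two_mul]; exact add_mem hx hx
  have half {x : A} (hx : 2 * x ∈ M) : x ∈ M := by
    have h := M.smul_mem (show (0 : ℝ) ≤ 1 / 2 by norm_num) hx
    rwa [two_mul, ← two_smul ℝ x, smul_smul, one_div, inv_mul_cancel₀ two_ne_zero, one_smul] at h
  rw [PointedCone.mem_lineal] at hpq hpr ⊢
  have neg_sq {s : A} (hs : 1 - s ^ 2 ∈ M) (hps : p * s - 1 ∈ M) : -(p - s) ^ 2 ∈ M := by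
    have h := add_mem (add_mem hp hs) (two hps)
    convert h using 1
    ring
  have hq' : q ^ 2 - 1 ∈ M := by
    convert add_mem (add_mem (hD _ (D.sub_mem hpD hqD)) hp) (two hpq.1) using 1
    ring
  have hr' : r ^ 2 - 1 ∈ M := by
    convert add_mem (add_mem (hD _ (D.sub_mem hpD hrD)) hp) (two hpr.1) using 1
    ring
  constructor <;> apply half
  · have h1 := hD _ (D.sub_mem (D.sub_mem (D.add_mem hpD hpD) hqD) hrD)
    convert add_mem (add_mem (add_mem h1 (two (neg_sq hq hpq.1))) (two (neg_sq hr hpr.1)))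
      (add_mem hq' hr') using 1
    ring
  · convert add_mem (add_mem (hD _ (D.sub_mem hqD hrD)) hq) hr using 1
    ring

/-! ### Generalized squares -/

/-- The pairs `{a, b}` and `{c, e}` agree coordinatewise as multisets. -/
def IsExchange {d : ℕ} {n : Fin d → ℕ} (a b c e : Idx n) : Prop :=
  ∀ k, (a k = c k ∧ b k = e k) ∨ (a k = e k ∧ b k = c k)

theorem IsExchange.mul_eq {d : ℕ} {n : Fin d → ℕ} {T : Idx n → ℝ} (hT : IsRankOne T)
    {a b c e : Idx n} (h : IsExchange a b c e) : T a * T b = T c * T e := by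
  obtain ⟨u, hu⟩ := hT
  simp only [hu, ← Finset.prod_mul_distrib]
  refine Finset.prod_congr rfl fun k _ => ?_
  rcases h k with ⟨h₁, h₂⟩ | ⟨h₁, h₂⟩ <;> rw [h₁, h₂]
  exact mul_comm _ _

theorem IsExchange.sub_mem_J2span {d : ℕ} {n : Fin d → ℕ} {a b c e : Idx n}
    (h : IsExchange a b c e) :
    (MvPolynomial.X a * MvPolynomial.X b - MvPolynomial.X c * MvPolynomial.X e :
      MvPolynomial (Idx n) ℝ) ∈ J2span n := by
  by_cases hs : IsSquare a b c e
  · exact Submodule.subset_span ⟨a, b, c, e, hs, rfl⟩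
  have hmm (k : Fin d) : max (a k) (b k) = max (c k) (e k) ∧
      min (a k) (b k) = min (c k) (e k) := by
    rcases h k with ⟨h₁, h₂⟩ | ⟨h₁, h₂⟩ <;> rw [h₁, h₂]
    · exact ⟨rfl, rfl⟩
    · exact ⟨max_comm _ _, min_comm _ _⟩
  have hdeg : (a = c ∧ b = e) ∨ (a = e ∧ b = c) := by
    by_contra hne
    refine hs ⟨?_, hmm⟩
    simp only [List.nodup_cons, List.mem_cons, List.not_mem_nil, or_false, not_or, not_false_eq_true,
      List.nodup_nil, and_true]
    refine ⟨⟨?_, ?_, ?_⟩, ⟨?_, ?_⟩, ?_⟩ <;> rintro rfl <;> apply hne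
    · left; constructor <;> funext k <;> have := h k <;> grind
    · left; refine ⟨rfl, ?_⟩; funext k; have := h k; grind
    · right; refine ⟨rfl, ?_⟩; funext k; have := h k; grind
    · right; refine ⟨?_, rfl⟩; funext k; have := h k; grind
    · left; refine ⟨?_, rfl⟩; funext k; have := h k; grind
    · left; constructor <;> funext k <;> have := h k <;> grind
  rcases hdeg with ⟨rfl, rfl⟩ | ⟨rfl, rfl⟩
  · rw [sub_self]; exact zero_mem _
  · rw [mul_comm, sub_self]; exact zero_mem _

/-- In each coordinate the four entries of a generalized square split into two equal pairs. -/
theorem IsGenSquare.coord {d : ℕ} {n : Fin d → ℕ} {α₁ α₂ α₃ β : Idx n}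
    (h : IsGenSquare α₁ α₂ α₃ β) (k : Fin d) :
    (α₁ k = α₂ k ∧ α₃ k = β k) ∨ (α₁ k = α₃ k ∧ α₂ k = β k) ∨ (α₁ k = β k ∧ α₂ k = α₃ k) := by
  have hj (j : Fin (n k)) : ((if α₁ k = j then 1 else 0) + (if α₂ k = j then 1 else 0) +
      (if α₃ k = j then 1 else 0) + (if β k = j then 1 else 0) : ZMod 2) = 0 :=
    congrFun h.2 ⟨k, j⟩
  have two : (1 + 1 : ZMod 2) = 0 := by decide
  by_cases h12 : α₁ k = α₂ k
  · have h := hj (α₃ k)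
    rw [h12] at h
    by_cases h34 : β k = α₃ k
    · exact .inl ⟨h12, h34.symm⟩
    · by_cases h23 : α₂ k = α₃ k <;> simp [h23, h34, two] at h
  · have h₁ := hj (α₁ k)
    have h₂ := hj (α₂ k)
    rw [if_pos rfl, if_neg (Ne.symm h12)] at h₁
    rw [if_pos rfl, if_neg h12] at h₂
    by_cases h13 : α₃ k = α₁ k
    · rw [h13, if_neg h12] at h₂
      by_cases h24 : β k = α₂ k
      · exact .inr (.inl ⟨h13.symm, h24.symm⟩)
      · simp [h24] at h₂
    · by_cases h14 : β k = α₁ k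
      · rw [h14, if_neg h12] at h₂
        by_cases h23 : α₃ k = α₂ k
        · exact .inr (.inr ⟨h14.symm, h23.symm⟩)
        · simp [h23] at h₂
      · simp [h13, h14] at h₁

/-- A generalized square is linked by exchanges through three auxiliary tuples. -/
theorem IsGenSquare.exists_exchange {d : ℕ} {n : Fin d → ℕ} {α₁ α₂ α₃ β : Idx n}
    (h : IsGenSquare α₁ α₂ α₃ β) :
    ∃ p q r : Idx n, IsExchange α₁ α₂ p q ∧ IsExchange α₁ α₃ p r ∧ IsExchange α₁ β r q := by
  have hk (k : Fin d) : ∃ p q r : Fin (n k),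
      ((α₁ k = p ∧ α₂ k = q) ∨ (α₁ k = q ∧ α₂ k = p)) ∧
      ((α₁ k = p ∧ α₃ k = r) ∨ (α₁ k = r ∧ α₃ k = p)) ∧
      ((α₁ k = r ∧ β k = q) ∨ (α₁ k = q ∧ β k = r)) := by
    rcases h.coord k with ⟨h₁, h₂⟩ | ⟨h₁, h₂⟩ | ⟨h₁, h₂⟩
    · exact ⟨α₁ k, α₁ k, α₃ k, by grind⟩
    · exact ⟨α₁ k, α₂ k, α₁ k, by grind⟩
    · exact ⟨α₂ k, α₁ k, α₁ k, by grind⟩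
  choose p q r hpqr using hk
  exact ⟨p, q, r, fun k => (hpqr k).1, fun k => (hpqr k).2.1, fun k => (hpqr k).2.2⟩

theorem PGS.ne_zero {d : ℕ} {n : Fin d → ℕ} {Ω : Set (Idx n)} {T : Idx n → ℝ}
    (hT : IsRankOne T) (hnz : ∀ α ∈ Ω, T α ≠ 0) {β : Idx n} (hβ : PGS Ω β) : T β ≠ 0 := by
  induction hβ with
  | base h => exact hnz _ h
  | prop hsq _ _ _ ih₁ ih₂ ih₃ =>
    obtain ⟨p, q, r, hpq, hpr, hrq⟩ := hsq.exists_exchange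
    have h₂ := hpq.mul_eq hT ▸ mul_ne_zero ih₁ ih₂
    have h₃ := hpr.mul_eq hT ▸ mul_ne_zero ih₁ ih₃
    have h := mul_ne_zero (right_ne_zero_of_mul h₃) (right_ne_zero_of_mul h₂)
    rw [← hrq.mul_eq hT] at h
    exact right_ne_zero_of_mul h

/-! ### The cone of certificates -/

theorem SigmaN2.zero {d : ℕ} {n : Fin d → ℕ} : SigmaN2 (0 : MvPolynomial (Idx n) ℝ) :=
  ⟨⟨0, Fin.elim0, by simp⟩, by simp⟩

theorem SigmaN2.add {d : ℕ} {n : Fin d → ℕ} {p q : MvPolynomial (Idx n) ℝ}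
    (hp : SigmaN2 p) (hq : SigmaN2 q) : SigmaN2 (p + q) := by
  obtain ⟨⟨k, f, rfl⟩, hp⟩ := hp
  obtain ⟨⟨l, g, rfl⟩, hq⟩ := hq
  exact ⟨⟨k + l, Fin.append f g, by simp [Fin.sum_univ_add]⟩,
    (MvPolynomial.totalDegree_add _ _).trans (max_le hp hq)⟩

theorem SigmaN2.smul {d : ℕ} {n : Fin d → ℕ} {p : MvPolynomial (Idx n) ℝ} {c : ℝ} (hc : 0 ≤ c)
    (hp : SigmaN2 p) : SigmaN2 (c • p) := by
  obtain ⟨⟨k, f, rfl⟩, hp⟩ := hp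
  refine ⟨⟨k, fun i => √c • f i, ?_⟩, (MvPolynomial.totalDegree_smul_le _ _).trans hp⟩
  simp only [smul_pow, Real.sq_sqrt hc, Finset.smul_sum]

theorem SigmaN2.sq {d : ℕ} {n : Fin d → ℕ} {q : MvPolynomial (Idx n) ℝ}
    (hq : q.totalDegree ≤ 1) : SigmaN2 (q ^ 2) :=
  ⟨⟨1, fun _ => q, by simp⟩, (MvPolynomial.totalDegree_pow _ _).trans (by omega)⟩

/-- The polynomials which, after adding a nonnegative combination of the `x_γ² - T_γ²`, become
sums of squares of degree at most 2 modulo `I₂ + J₂`. -/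
noncomputable def certCone {d : ℕ} {n : Fin d → ℕ} (Ω : Set (Idx n)) (T : Idx n → ℝ) :
    PointedCone ℝ (MvPolynomial (Idx n) ℝ) where
  carrier := {p | ∃ (w : Idx n → ℝ) (s : MvPolynomial (Idx n) ℝ), (∀ γ, 0 ≤ w γ) ∧ SigmaN2 s ∧
    p + ∑ γ, w γ • gPoly T γ - s ∈ I2span Ω T ⊔ J2span n}
  zero_mem' := ⟨0, 0, fun _ => le_rfl, .zero, by simp⟩
  add_mem' := by
    rintro p q ⟨w, s, hw, hs, hp⟩ ⟨v, t, hv, ht, hq⟩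
    refine ⟨w + v, s + t, fun γ => add_nonneg (hw γ) (hv γ), hs.add ht, ?_⟩
    convert add_mem hp hq using 1
    simp only [Pi.add_apply, add_smul, Finset.sum_add_distrib]
    ring
  smul_mem' := by
    rintro ⟨c, hc⟩ p ⟨w, s, hw, hs, hp⟩
    refine ⟨c • w, c • s, fun γ => mul_nonneg hc (hw γ), hs.smul hc, ?_⟩
    convert Submodule.smul_mem _ c hp using 1
    simp only [smul_sub, smul_add, Finset.smul_sum, smul_smul, Pi.smul_apply, smul_eq_mul]
    rfl

section certCone

variable {d : ℕ} {n : Fin d → ℕ} {Ω : Set (Idx n)} {T : Idx n → ℝ}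

theorem sq_mem_certCone {q : MvPolynomial (Idx n) ℝ}
    (hq : q ∈ MvPolynomial.restrictTotalDegree (Idx n) ℝ 1) : q ^ 2 ∈ certCone Ω T :=
  ⟨0, q ^ 2, fun _ => le_rfl, .sq ((MvPolynomial.mem_restrictTotalDegree _ _ _).1 hq), by simp⟩

theorem neg_gPoly_mem_certCone (γ : Idx n) : -gPoly T γ ∈ certCone Ω T := by
  classical
  refine ⟨Pi.single γ 1, 0, fun δ => ?_, .zero, ?_⟩
  · by_cases h : δ = γ
    · subst h; simp
    · simp [h]
  · simp [Pi.single_apply]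

theorem mem_lineal_certCone {p : MvPolynomial (Idx n) ℝ} (hp : p ∈ I2span Ω T ⊔ J2span n) :
    p ∈ (certCone Ω T).lineal := by
  have h {p : MvPolynomial (Idx n) ℝ} (hp : p ∈ I2span Ω T ⊔ J2span n) : p ∈ certCone Ω T :=
    ⟨0, 0, fun _ => le_rfl, .zero, by simpa using hp⟩
  exact ⟨h hp, h (neg_mem hp)⟩

/-- The variable `x_γ`, normalized to take the value `1` at `T`. -/
noncomputable def normX (T : Idx n → ℝ) (γ : Idx n) : MvPolynomial (Idx n) ℝ :=
  (T γ)⁻¹ • MvPolynomial.X γ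

theorem normX_mem (γ : Idx n) : normX T γ ∈ MvPolynomial.restrictTotalDegree (Idx n) ℝ 1 :=
  Submodule.smul_mem _ _ <| (MvPolynomial.mem_restrictTotalDegree _ _ _).2
    (MvPolynomial.totalDegree_X γ).le

theorem fPoly_eq_smul {γ : Idx n} (h : T γ ≠ 0) : fPoly T γ = T γ • (normX T γ - 1) := by
  rw [fPoly, normX, smul_sub, smul_smul, mul_inv_cancel₀ h, one_smul, MvPolynomial.smul_eq_C_mul,
    mul_one]

theorem one_sub_normX_sq_mem {γ : Idx n} (h : T γ ≠ 0) : 1 - normX T γ ^ 2 ∈ certCone Ω T := by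
  convert (certCone Ω T).smul_mem (sq_nonneg (T γ)⁻¹) (neg_gPoly_mem_certCone γ) using 1
  have hC : (T γ)⁻¹ ^ 2 • (MvPolynomial.C (T γ ^ 2) : MvPolynomial (Idx n) ℝ) = 1 := by
    rw [MvPolynomial.smul_eq_C_mul, ← MvPolynomial.C_mul, ← mul_pow, inv_mul_cancel₀ h, one_pow,
      MvPolynomial.C_1]
  rw [gPoly, neg_sub, smul_sub, hC, normX, smul_pow]

theorem IsExchange.normX_mem_lineal (hT : IsRankOne T) {a b c e : Idx n}
    (h : IsExchange a b c e) :
    normX T a * normX T b - normX T c * normX T e ∈ (certCone Ω T).lineal := by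
  refine mem_lineal_certCone (Submodule.mem_sup_right ?_)
  convert Submodule.smul_mem _ (T a * T b)⁻¹ h.sub_mem_J2span using 1
  simp only [normX, smul_mul_smul_comm, ← mul_inv, smul_sub]
  rw [h.mul_eq hT]

theorem PGS.normX_sub_one_mem_lineal (hT : IsRankOne T) (hnz : ∀ γ, T γ ≠ 0) {β : Idx n}
    (hβ : PGS Ω β) : normX T β - 1 ∈ (certCone Ω T).lineal := by
  have one_mem : (1 : MvPolynomial (Idx n) ℝ) ∈ MvPolynomial.restrictTotalDegree (Idx n) ℝ 1 :=
    (MvPolynomial.mem_restrictTotalDegree _ _ _).2 (by simp)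
  have one_bdd : 1 - (1 : MvPolynomial (Idx n) ℝ) ^ 2 ∈ certCone Ω T := by simp
  have hsq : ∀ q ∈ MvPolynomial.restrictTotalDegree (Idx n) ℝ 1, q ^ 2 ∈ certCone Ω T :=
    fun _ => sq_mem_certCone
  have link {a b c : Idx n} (hab : normX T a * normX T b - 1 ∈ (certCone Ω T).lineal)
      (hac : normX T a * normX T c - 1 ∈ (certCone Ω T).lineal) :
      normX T b * normX T c - 1 ∈ (certCone Ω T).lineal :=
    mul_sub_one_mem_lineal hsq (normX_mem a) (normX_mem b) (normX_mem c)
      (one_sub_normX_sq_mem (hnz a)) (one_sub_normX_sq_mem (hnz b))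
      (one_sub_normX_sq_mem (hnz c)) hab hac
  have mul_mem {a b : Idx n} (ha : normX T a - 1 ∈ (certCone Ω T).lineal)
      (hb : normX T b - 1 ∈ (certCone Ω T).lineal) :
      normX T a * normX T b - 1 ∈ (certCone Ω T).lineal :=
    mul_sub_one_mem_lineal hsq one_mem (normX_mem a) (normX_mem b) one_bdd
      (one_sub_normX_sq_mem (hnz a)) (one_sub_normX_sq_mem (hnz b))
      (by rwa [one_mul]) (by rwa [one_mul])
  induction hβ with
  | @base α h =>
    have hf : fPoly T α ∈ (certCone Ω T).lineal :=
      mem_lineal_certCone (Submodule.mem_sup_left (Submodule.subset_span (.inl ⟨α, h, rfl⟩)))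
    rwa [fPoly_eq_smul (hnz α), Submodule.smul_mem_iff _ (hnz α)] at hf
  | @prop α₁ α₂ α₃ β hgs _ _ _ ih₁ ih₂ ih₃ =>
    obtain ⟨p, q, r, hpq, hpr, hrq⟩ := hgs.exists_exchange
    have hpq' : normX T p * normX T q - 1 ∈ (certCone Ω T).lineal := by
      convert sub_mem (mul_mem ih₁ ih₂) (hpq.normX_mem_lineal hT) using 1
      ring
    have hpr' : normX T p * normX T r - 1 ∈ (certCone Ω T).lineal := by
      convert sub_mem (mul_mem ih₁ ih₃) (hpr.normX_mem_lineal hT) using 1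
      ring
    have hβ : normX T α₁ * normX T β - 1 ∈ (certCone Ω T).lineal := by
      convert add_mem (link hpr' hpq') (hrq.normX_mem_lineal hT) using 1
      ring
    have h := mul_sub_one_mem_lineal hsq (normX_mem α₁) one_mem (normX_mem β)
      (one_sub_normX_sq_mem (hnz α₁)) one_bdd (one_sub_normX_sq_mem (hnz β))
      (by rwa [mul_one]) hβ
    rwa [one_mul] at h

end certCone

/-- Under GS-propagation, for every unobserved `β` and constant `c_β`
there are a set `S_β`, nonnegative weights, and `p̃_β ∈ Σ_{N,2}` with
`(x_β² - T_β²) + Σ_{γ∈S_β} w_γ (x_γ² - T_γ²) = -2c_β(x_β - T_β) + p̃_β mod (I₂+J₂)`. -/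
theorem statement18 {d : ℕ} {n : Fin d → ℕ} (Ω : Set (Idx n))
    (T : Idx n → ℝ) (hGS : GSPropagation Ω) (hnz : ∀ α ∈ Ω, T α ≠ 0)
    (hT : IsRankOne T)
    (huniq : ∀ T' : Idx n → ℝ, IsRankOne T' → (∀ α ∈ Ω, T' α = T α) → T' = T)
    (β : Idx n) (hβ : β ∉ Ω) (cβ : ℝ) :
    ∃ (S : Finset (Idx n)) (w : Idx n → ℝ) (ptil : MvPolynomial (Idx n) ℝ),
      (∀ γ ∈ S, 0 ≤ w γ) ∧ SigmaN2 ptil ∧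
      ((MvPolynomial.X β ^ 2 - MvPolynomial.C (T β ^ 2)) +
          (∑ γ ∈ S, MvPolynomial.C (w γ) *
            (MvPolynomial.X γ ^ 2 - MvPolynomial.C (T γ ^ 2))) -
          (MvPolynomial.C (-(2 * cβ)) * (MvPolynomial.X β - MvPolynomial.C (T β))
            + ptil)
        ∈ I2span Ω T ⊔ J2span n) := by

  have hne (γ : Idx n) : T γ ≠ 0 := (hGS γ).ne_zero hT hnz
  have hf : fPoly T β ∈ (certCone Ω T).lineal := by
    rw [fPoly_eq_smul (hne β)]
    exact Submodule.smul_mem _ _ ((hGS β).normX_sub_one_mem_lineal hT hne)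
  have hdeg : fPoly T β ∈ MvPolynomial.restrictTotalDegree (Idx n) ℝ 1 := by
    refine (MvPolynomial.mem_restrictTotalDegree _ _ _).2 ?_
    exact (MvPolynomial.totalDegree_sub_C_le _ _).trans (MvPolynomial.totalDegree_X β).le
  obtain ⟨w, s, hw, hs, h⟩ : fPoly T β ^ 2 + (2 * T β + 2 * cβ) • fPoly T β ∈ certCone Ω T :=
    add_mem (sq_mem_certCone hdeg) (Submodule.smul_mem _ _ hf).1
  refine ⟨Finset.univ, w, s, fun γ _ => hw γ, hs, ?_⟩
  convert h using 1
  simp only [fPoly, gPoly, MvPolynomial.smul_eq_C_mul, map_add, map_mul, map_neg, map_pow,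
    map_ofNat]
  ring

end RankOneTC
end
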